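/- There is no function φ : ℂ → ℂ meromorphic on all of ℂ such that φ(z) ≠ 1 at every point z where φ is analytic, φ is analytic at 0 with φ(0) = 0 and φ is not identically zero, φ has no poles on the unit circle, and |φ(z)| > 1 for all z with |z| = 1. -/

import Mathlib

open Topology Filter

/-- An entire function vanishing at the origin has real part at most `1 / 2` somewhere on the unit
circle. -/
lemma exists_re_le_half_of_differentiable {g : ℂ → ℂ} (hg : Differentiable ℂ g) (h0 : g 0 = 0) :
    ∃ z : ℂ, ‖z‖ = 1 ∧ (g z).re ≤ 1 / 2 := by
  by_contra! h
  have hd : DiffContOnCl ℂ (fun z => Complex.exp (-g z)) (Metric.ball 0 1) :=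
    (hg.neg.cexp).diffContOnCl
  have hle : ‖Complex.exp (-g 0)‖ ≤ Real.exp (-(1 / 2)) := by
    refine Complex.norm_le_of_forall_mem_frontier_norm_le Metric.isBounded_ball hd (fun z hz => ?_)
      (subset_closure (Metric.mem_ball_self one_pos))
    rw [frontier_ball _ one_ne_zero, mem_sphere_zero_iff_norm] at hz
    rw [Complex.norm_exp, Complex.neg_re, Real.exp_le_exp]
    linarith [h z hz]
  rw [h0, neg_zero, Complex.norm_exp, Complex.zero_re, Real.exp_le_exp] at hle
  norm_num at hle

/-- The Möbius map `w ↦ 1 + (w - 1)⁻¹` sends the exterior of the unit disc into the half-plane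
`1 / 2 < re`. -/
lemma half_lt_re_one_add_inv_sub_one {w : ℂ} (hw : 1 < ‖w‖) (hw1 : w ≠ 1) :
    1 / 2 < (1 + (w - 1)⁻¹).re := by
  have hpos : 0 < Complex.normSq (w - 1) := Complex.normSq_pos.mpr (sub_ne_zero.mpr hw1)
  have hsq : 1 < Complex.normSq w := by
    rw [Complex.normSq_eq_norm_sq]
    nlinarith
  rw [Complex.add_re, Complex.inv_re, Complex.one_re, ← sub_pos]
  have : 1 + (w - 1).re / Complex.normSq (w - 1) - 1 / 2
      = (Complex.normSq w - 1) / (2 * Complex.normSq (w - 1)) := by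
    field_simp
    simp only [Complex.normSq_apply, Complex.sub_re, Complex.sub_im, Complex.one_re,
      Complex.one_im]
    ring
  rw [this]
  exact div_pos (by linarith) (by linarith)

lemma not_analyticAt_of_tendsto_norm_atTop {φ : ℂ → ℂ} {p : ℂ}
    (hp : Tendsto (fun z => ‖φ z‖) (𝓝[≠] p) atTop) : ¬ AnalyticAt ℂ φ p := fun h =>
  not_tendsto_nhds_of_tendsto_atTop hp _ (h.continuousAt.norm.tendsto.mono_left nhdsWithin_le_nhds)

/-- Argument-principle impossibility: there is no function `φ` meromorphic on `ℂ`
(analytic off a set `P` of isolated points, with `‖φ‖ → ∞` at each point of `P`)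
such that `φ ≠ 1` wherever `φ` is analytic, `φ` is analytic at `0` with `φ(0) = 0`,
`φ` is not identically zero, `φ` has no poles on the unit circle, and `|φ| > 1`
on the unit circle. -/
theorem no_meromorphic_function_large_on_circle
    (φ : ℂ → ℂ) (P : Set ℂ)
    -- the poles are isolated:
    (hPiso : ∀ p ∈ P, ∃ V ∈ 𝓝 p, ∀ q ∈ V, q ≠ p → q ∉ P)
    -- `φ` is analytic off `P`:
    (hφ : AnalyticOnNhd ℂ φ Pᶜ)
    -- each point of `P` is a pole of `φ`:
    (hP : ∀ p ∈ P, Tendsto (fun z => ‖φ z‖) (𝓝[≠] p) atTop)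
    -- `φ ≠ 1` at every point where `φ` is analytic:
    (hne1 : ∀ z : ℂ, AnalyticAt ℂ φ z → φ z ≠ 1)
    (h0 : AnalyticAt ℂ φ 0) (h00 : φ 0 = 0)
    -- `φ` is not identically zero:
    (hnz : ∃ z : ℂ, φ z ≠ 0)
    -- `φ` has no poles on the unit circle:
    (hcirc : ∀ z : ℂ, ‖z‖ = 1 → z ∉ P)
    (hbig : ∀ z : ℂ, ‖z‖ = 1 → 1 < ‖φ z‖) :
    False := by
  classical
  have hnot : ∀ z, AnalyticAt ℂ φ z → z ∉ P := fun z hz hzP =>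
    not_analyticAt_of_tendsto_norm_atTop (hP z hzP) hz
  set g : ℂ → ℂ := fun z => if z ∈ P then 1 else 1 + (φ z - 1)⁻¹ with hgdef
  have hgP : ∀ z ∉ P, g z = 1 + (φ z - 1)⁻¹ := fun z hz => if_neg hz
  have hoff : ∀ z ∉ P, DifferentiableAt ℂ g z := fun z hz => by
    have han := hφ z hz
    have heq : g =ᶠ[𝓝 z] fun w => 1 + (φ w - 1)⁻¹ :=
      han.eventually_analyticAt.mono fun w hw => hgP w (hnot w hw)
    refine DifferentiableAt.congr_of_eventuallyEq ?_ heq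
    exact ((han.differentiableAt.sub_const 1).inv (sub_ne_zero.mpr (hne1 z han))).const_add 1
  have hg : Differentiable ℂ g := fun p => by
    by_cases hp : p ∈ P
    · obtain ⟨V, hV, hVP⟩ := hPiso p hp
      have hev : ∀ᶠ z in 𝓝[≠] p, z ∉ P := by
        filter_upwards [mem_nhdsWithin_of_mem_nhds hV, self_mem_nhdsWithin] with z hz hzp
        exact hVP z hz hzp
      refine (Complex.analyticAt_of_differentiable_on_punctured_nhds_of_continuousAt
        (hev.mono hoff) ?_).differentiableAt
      have hinv : Tendsto (fun z => (φ z - 1)⁻¹) (𝓝[≠] p) (𝓝 0) := by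
        refine tendsto_inv₀_cobounded.comp (tendsto_norm_atTop_iff_cobounded.mp ?_)
        refine tendsto_atTop_mono (fun z => ?_) (tendsto_atTop_add_const_right _ (-1) (hP p hp))
        simpa [sub_eq_add_neg] using norm_sub_norm_le (φ z) 1
      have hlim : Tendsto (fun z => 1 + (φ z - 1)⁻¹) (𝓝[≠] p) (𝓝 (g p)) := by
        simpa [hgdef, hp] using hinv.const_add 1
      exact continuousAt_iff_punctured_nhds.mpr
        (hlim.congr' (hev.mono fun z hz => (hgP z hz).symm))
    · exact hoff p hp
  obtain ⟨z, hz, hre⟩ := exists_re_le_half_of_differentiable hg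
    (by rw [hgP 0 (hnot 0 h0), h00]; norm_num)
  rw [hgP z (hcirc z hz)] at hre
  exact hre.not_gt
    (half_lt_re_one_add_inv_sub_one (hbig z hz) (hne1 z (hφ z (hcirc z hz))))
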